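/- Let L = L₀ ⊕ L₁ be a Leibniz superalgebra over ℂ such that L₀, equipped with the restriction of the bracket, is a finite-dimensional semisimple complex Lie algebra. Then [x,y] = [y,x] for all x, y ∈ L₁. -/

import Mathlib

/-- A Leibniz superalgebra over ℂ, given by its even part `M0`, odd part `M1`,
four bilinear bracket maps, and all homogeneous instances of the graded Leibniz
identity `[x,[y,z]] = [[x,y],z] − (−1)^{αβ}[[x,z],y]` for `y ∈ L_α`, `z ∈ L_β`. -/
structure LeibnizSuperAlg (M0 M1 : Type) [AddCommGroup M0] [Module ℂ M0]
    [AddCommGroup M1] [Module ℂ M1] where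
  b00 : M0 →ₗ[ℂ] M0 →ₗ[ℂ] M0
  b01 : M0 →ₗ[ℂ] M1 →ₗ[ℂ] M1
  b10 : M1 →ₗ[ℂ] M0 →ₗ[ℂ] M1
  b11 : M1 →ₗ[ℂ] M1 →ₗ[ℂ] M0
  leib000 : ∀ (x y z : M0), b00 x (b00 y z) = b00 (b00 x y) z - b00 (b00 x z) y
  leib001 : ∀ (x y : M0) (z : M1), b01 x (b01 y z) = b01 (b00 x y) z - b10 (b01 x z) y
  leib010 : ∀ (x : M0) (y : M1) (z : M0), b01 x (b10 y z) = b10 (b01 x y) z - b01 (b00 x z) y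
  leib011 : ∀ (x : M0) (y z : M1), b00 x (b11 y z) = b11 (b01 x y) z + b11 (b01 x z) y
  leib100 : ∀ (x : M1) (y z : M0), b10 x (b00 y z) = b10 (b10 x y) z - b10 (b10 x z) y
  leib101 : ∀ (x : M1) (y : M0) (z : M1), b11 x (b01 y z) = b11 (b10 x y) z - b00 (b11 x z) y
  leib110 : ∀ (x y : M1) (z : M0), b11 x (b10 y z) = b00 (b11 x y) z - b11 (b10 x z) y
  leib111 : ∀ (x y z : M1), b10 x (b11 y z) = b01 (b11 x y) z + b01 (b11 x z) y

/-- If the even part of a Leibniz superalgebra over ℂ is a finite-dimensional semisimple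
complex Lie algebra (with the restricted bracket), then `[x,y] = [y,x]` for all `x, y` in
the odd part. -/
theorem odd_bracket_symm (H M1 : Type) [LieRing H] [LieAlgebra ℂ H]
    [FiniteDimensional ℂ H] [LieAlgebra.IsSemisimple ℂ H]
    [AddCommGroup M1] [Module ℂ M1] (S : LeibnizSuperAlg H M1)
    (hS : ∀ x y : H, S.b00 x y = ⁅x, y⁆) :
    ∀ x y : M1, S.b11 x y = S.b11 y x := by
  intro x y
  have hcomm : ∀ h : H, ⁅h, S.b11 x y - S.b11 y x⁆ = 0 := fun h => by
    rw [← hS, map_sub, S.leib011, S.leib011, add_comm, sub_self]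
  have hmem : S.b11 x y - S.b11 y x ∈ LieAlgebra.center ℂ H :=
    (LieModule.mem_maxTrivSubmodule ℂ H H _).mpr hcomm
  rw [LieAlgebra.center_eq_bot, LieSubmodule.mem_bot] at hmem
  exact sub_eq_zero.mp hmem
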